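/- Under the invariant-conditional assumption (and with all P₋₂-marginals strictly positive), the error of the hybrid predictor is exactly a linear functional of the most recent shift only: almost surely, τ^C − τ = −Σ_z Q(z₁) S₋₁(z). (Key identity in the proof of Theorem 2.) -/

import Mathlib

open MeasureTheory ProbabilityTheory

/-- Key identity in the proof of Theorem 2: under the invariant-conditional
assumption (with strictly positive `P₋₂`-marginals), the error of the hybrid
predictor is exactly a linear functional of the most recent shift only:
almost surely, `τ^C − τ = −Σ_z Q(z₁) S₋₁(z)`. -/
theorem hybrid_error_linear_in_recent_shift
    {Y1 Y2 : Type*} [Fintype Y1] [Fintype Y2] [Nonempty Y1] [Nonempty Y2]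
    (y2 : Y2 → ℝ)
    (pm2 : Y1 × Y2 → ℝ) (hpm2_nonneg : ∀ z, 0 ≤ pm2 z) (hpm2_sum : ∑ z, pm2 z = 1)
    {Ω : Type*} [MeasureSpace Ω] [IsProbabilityMeasure (ℙ : Measure Ω)]
    (Sm2 Sm1 : Ω → (Y1 × Y2) → ℝ)
    (hSm2_sum : ∀ᵐ ω ∂ℙ, ∑ z, Sm2 ω z = 0)
    (hSm1_sum : ∀ᵐ ω ∂ℙ, ∑ z, Sm1 ω z = 0)
    (hpm1_range : ∀ᵐ ω ∂ℙ, ∀ z, pm2 z + Sm2 ω z ∈ Set.Icc (0 : ℝ) 1)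
    (hp0_range : ∀ᵐ ω ∂ℙ, ∀ z, pm2 z + Sm2 ω z + Sm1 ω z ∈ Set.Icc (0 : ℝ) 1)
    -- invariant conditional distribution of the Y₂-coordinate given the Y₁-coordinate
    (q : Y1 × Y2 → ℝ) (hq_range : ∀ z, q z ∈ Set.Icc (0 : ℝ) 1)
    (hq_sum : ∀ u : Y1, ∑ v, q (u, v) = 1)
    (hinv_m2 : ∀ z : Y1 × Y2, pm2 z = (∑ v, pm2 (z.1, v)) * q z)
    (hinv_m1 : ∀ᵐ ω ∂ℙ, ∀ z : Y1 × Y2,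
      pm2 z + Sm2 ω z = (∑ v, (pm2 (z.1, v) + Sm2 ω (z.1, v))) * q z)
    (hinv_0 : ∀ᵐ ω ∂ℙ, ∀ z : Y1 × Y2,
      pm2 z + Sm2 ω z + Sm1 ω z
        = (∑ v, (pm2 (z.1, v) + Sm2 ω (z.1, v) + Sm1 ω (z.1, v))) * q z)
    -- strictly positive marginals
    (hmarg : ∀ u : Y1, 0 < ∑ v, pm2 (u, v)) :
    ∀ᵐ ω ∂ℙ,
      (∑ z, ((∑ v, y2 v * pm2 (z.1, v)) / (∑ v, pm2 (z.1, v))) * (pm2 z + Sm2 ω z))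
        - (∑ z, y2 z.2 * (pm2 z + Sm2 ω z + Sm1 ω z))
      = -∑ z, ((∑ v, y2 v * pm2 (z.1, v)) / (∑ v, pm2 (z.1, v))) * Sm1 ω z := by
  have hQ : ∀ u : Y1, (∑ v, y2 v * pm2 (u, v)) / (∑ v, pm2 (u, v)) = ∑ v, y2 v * q (u, v) := by
    intro u
    rw [div_eq_iff (hmarg u).ne', Finset.sum_mul]
    refine Finset.sum_congr rfl fun v _ => ?_
    have h := hinv_m2 (u, v)
    dsimp only at h
    rw [mul_assoc, mul_comm (q (u, v)), ← h]
  filter_upwards [hinv_0] with ω h0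
  simp only [hQ]
  have key : ∑ z : Y1 × Y2, y2 z.2 * (pm2 z + Sm2 ω z + Sm1 ω z)
      = ∑ z : Y1 × Y2, (∑ v, y2 v * q (z.1, v)) * (pm2 z + Sm2 ω z + Sm1 ω z) := by
    rw [Fintype.sum_prod_type, Fintype.sum_prod_type]
    refine Finset.sum_congr rfl fun u _ => ?_
    dsimp only
    rw [← Finset.mul_sum, Finset.sum_mul]
    refine Finset.sum_congr rfl fun v _ => ?_
    have h := h0 (u, v)
    dsimp only at h
    rw [h]
    ring
  rw [key, ← Finset.sum_sub_distrib, ← Finset.sum_neg_distrib]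
  refine Finset.sum_congr rfl fun z _ => ?_
  ring
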